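/- Suppose a_γ is a family of real numbers indexed by γ ∈ Γ with counting function N(x) = #{γ : r(γ) ≤ x} satisfying N(x) ~ C e^x, and suppose Σ_{r(γ)≤x} ⟨γ⟩^{2m} ~ C·c^m·(2m)!/(m!)·e^x x^m and Σ_{r(γ)≤x} ⟨γ⟩^{2m+1} = O(e^x x^m) for all m ≥ 0, where C, c > 0. Then the normalized values [γ] = ⟨γ⟩/√(2c·r(γ)) have asymptotically Gaussian distribution: #{γ : r(γ) ≤ x, [γ] ∈ [a,b]}/N(x) → (1/√(2π))∫_a^b e^{-t²/2} dt as x → ∞. -/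

import Mathlib

open Filter MeasureTheory Real Asymptotics

open Finset ProbabilityTheory
open scoped BigOperators NNReal ENNReal Topology

/-- The moments of the standard Gaussian distribution on `ℝ`. -/
noncomputable def stdGaussianMoment (k : ℕ) : ℝ :=
  if Even k then (k.factorial : ℝ) / (2 ^ (k / 2) * (k / 2).factorial) else 0

lemma stdGaussianMoment_two_mul (m : ℕ) :
    stdGaussianMoment (2 * m) = ((2 * m).factorial : ℝ) / (2 ^ m * m.factorial) := by
  simp [stdGaussianMoment]

lemma stdGaussianMoment_two_mul_add_one (m : ℕ) : stdGaussianMoment (2 * m + 1) = 0 := by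
  simp [stdGaussianMoment]

/-- Taylor's estimate for the exponential along a ray in the imaginary axis. -/
lemma norm_exp_mul_sub_sum_range_le {z : ℂ} (hz : z.re = 0) (n : ℕ) {s : ℝ} (hs : 0 ≤ s) :
    ‖Complex.exp (z * s) - ∑ k ∈ range n, (z * s) ^ k / k.factorial‖ ≤
      (‖z‖ * s) ^ n / n.factorial := by
  induction n generalizing s with
  | zero => simp [Complex.norm_exp, hz]
  | succ n ih =>
    have hlin (x : ℝ) : HasDerivAt (fun y : ℝ => z * (y : ℂ)) z x := by
      simpa using (Complex.ofRealCLM.hasDerivAt (x := x)).const_mul z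
    have hsum (x : ℝ) : HasDerivAt
        (fun y : ℝ => ∑ k ∈ range (n + 1), (z * (y : ℂ)) ^ k / (k.factorial : ℂ))
        (z * ∑ k ∈ range n, (z * (x : ℂ)) ^ k / (k.factorial : ℂ)) x := by
      have h := HasDerivAt.fun_sum (u := range (n + 1)) fun k _ =>
        (((hlin x).pow k).div_const (k.factorial : ℂ))
      refine h.congr_deriv ?_
      rw [sum_range_succ', mul_sum]
      simp only [Nat.cast_zero, zero_mul, zero_div, add_zero]
      refine sum_congr rfl fun k _ => ?_
      have h1 : (k.factorial : ℂ) ≠ 0 := mod_cast k.factorial_ne_zero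
      have h2 : ((k : ℂ) + 1) ≠ 0 := mod_cast k.succ_ne_zero
      rw [Nat.factorial_succ]
      push_cast
      field_simp
    have hf (x : ℝ) := ((hlin x).cexp).sub (hsum x)
    have hB (x : ℝ) : HasDerivAt (fun y : ℝ => (‖z‖ * y) ^ (n + 1) / ((n + 1).factorial : ℝ))
        (‖z‖ * ((‖z‖ * x) ^ n / (n.factorial : ℝ))) x := by
      have h := ((((hasDerivAt_id x).const_mul ‖z‖).pow (n + 1)).div_const
        ((n + 1).factorial : ℝ))
      refine h.congr_deriv ?_
      have h1 : (n.factorial : ℝ) ≠ 0 := mod_cast n.factorial_ne_zero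
      have h2 : ((n : ℝ) + 1) ≠ 0 := mod_cast n.succ_ne_zero
      rw [Nat.factorial_succ]
      push_cast
      simp only [id]
      field_simp
    refine image_norm_le_of_norm_deriv_right_le_deriv_boundary (a := 0) (b := s)
      (fun x _ => (hf x).continuousAt.continuousWithinAt)
      (fun x _ => (hf x).hasDerivWithinAt) ?_ hB (fun x hx => ?_) ⟨hs, le_rfl⟩
    · simp [sum_range_succ']
    · rw [mul_comm (Complex.exp _), ← mul_sub, norm_mul]
      exact mul_le_mul_of_nonneg_left (ih hx.1) (norm_nonneg _)

lemma norm_cexp_mul_I_sub_sum_range_le (y : ℝ) (n : ℕ) :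
    ‖Complex.exp (y * Complex.I) - ∑ k ∈ range n, (y * Complex.I) ^ k / k.factorial‖ ≤
      |y| ^ n / n.factorial := by
  simpa using norm_exp_mul_sub_sum_range_le (z := y * Complex.I) (by simp) n zero_le_one

lemma sum_range_two_mul_stdGaussianMoment (t : ℝ) (n : ℕ) :
    ∑ k ∈ range (2 * n), (t * Complex.I) ^ k / k.factorial * (stdGaussianMoment k : ℂ) =
      ∑ j ∈ range n, (-(t : ℂ) ^ 2 / 2) ^ j / j.factorial := by
  induction n with
  | zero => simp
  | succ n ih =>
    rw [show 2 * (n + 1) = 2 * n + 1 + 1 by ring, sum_range_succ, sum_range_succ,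
      sum_range_succ _ n, ih, stdGaussianMoment_two_mul, stdGaussianMoment_two_mul_add_one]
    have h1 : ((2 * n).factorial : ℂ) ≠ 0 := mod_cast (2 * n).factorial_ne_zero
    have h2 : (n.factorial : ℂ) ≠ 0 := mod_cast n.factorial_ne_zero
    have h3 : (t * Complex.I) ^ (2 * n) = (-(t : ℂ) ^ 2) ^ n := by
      rw [pow_mul, mul_pow, Complex.I_sq]; ring
    rw [h3, div_pow]
    push_cast
    field_simp
    ring

section Expectation

variable {Γ ι : Type*} {l : Filter ι} {s : ι → Finset Γ} {X Y : ι → Γ → ℝ}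

lemma norm_expect_cexp_sub_sum_range_le (s : Finset Γ) (X : Γ → ℝ) (t : ℝ) (n : ℕ) :
    ‖(𝔼 γ ∈ s, Complex.exp (t * X γ * Complex.I)) -
        ∑ k ∈ range (2 * n), (t * Complex.I) ^ k / k.factorial *
          ((𝔼 γ ∈ s, X γ ^ k : ℝ) : ℂ)‖ ≤
      t ^ (2 * n) / (2 * n).factorial * 𝔼 γ ∈ s, X γ ^ (2 * n) := by
  have h : ∑ k ∈ range (2 * n), (t * Complex.I) ^ k / k.factorial *
      ((𝔼 γ ∈ s, X γ ^ k : ℝ) : ℂ) =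
      𝔼 γ ∈ s, ∑ k ∈ range (2 * n), ((t * X γ : ℝ) * Complex.I) ^ k / k.factorial := by
    rw [expect_sum_comm]
    refine sum_congr rfl fun k _ => ?_
    rw [← RCLike.ofReal_eq_complex_ofReal, RCLike.ofReal_expect, mul_expect]
    refine expect_congr rfl fun γ _ => ?_
    simp only [RCLike.ofReal_eq_complex_ofReal]
    push_cast
    ring
  rw [h, ← expect_sub_distrib, mul_expect]
  refine (RCLike.norm_expect_le (K := ℂ)).trans (expect_le_expect fun γ _ => ?_)
  have := norm_cexp_mul_I_sub_sum_range_le (t * X γ) (2 * n)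
  rw [pow_mul, sq_abs, ← pow_mul, mul_pow] at this
  rw [Complex.ofReal_mul] at this ⊢
  exact this.trans_eq (by ring)

/-- Convergence of all moments to those of the standard Gaussian implies pointwise convergence of
characteristic functions. -/
lemma tendsto_expect_cexp_of_tendsto_expect_pow
    (h : ∀ k, Tendsto (fun i => 𝔼 γ ∈ s i, X i γ ^ k) l (𝓝 (stdGaussianMoment k))) (t : ℝ) :
    Tendsto (fun i => 𝔼 γ ∈ s i, Complex.exp (t * X i γ * Complex.I)) l
      (𝓝 (Complex.exp (-(t : ℂ) ^ 2 / 2))) := by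
  rw [Metric.tendsto_nhds]
  intro ε hε
  set Q : ℕ → ℂ := fun n => ∑ j ∈ range n, (-(t : ℂ) ^ 2 / 2) ^ j / j.factorial
  have hQ : Tendsto Q atTop (𝓝 (Complex.exp (-(t : ℂ) ^ 2 / 2))) := by
    rw [Complex.exp_eq_exp_ℂ]
    exact (NormedSpace.expSeries_div_hasSum_exp _).tendsto_sum_nat
  have hR : Tendsto (fun n : ℕ => (t ^ 2 / 2) ^ n / n.factorial +
      dist (Q n) (Complex.exp (-(t : ℂ) ^ 2 / 2))) atTop (𝓝 0) := by
    simpa using (FloorSemiring.tendsto_pow_div_factorial_atTop (t ^ 2 / 2)).add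
      (tendsto_iff_dist_tendsto_zero.1 hQ)
  obtain ⟨n, hn⟩ := (hR.eventually_lt_const hε).exists
  set P : ι → ℂ := fun i => ∑ k ∈ range (2 * n), (t * Complex.I) ^ k / k.factorial *
    ((𝔼 γ ∈ s i, X i γ ^ k : ℝ) : ℂ)
  have hP : Tendsto P l (𝓝 (Q n)) := by
    simp only [Q]
    rw [← sum_range_two_mul_stdGaussianMoment]
    exact tendsto_finsetSum _ fun k _ =>
      ((Complex.continuous_ofReal.tendsto _).comp (h k)).const_mul _
  have hM : Tendsto (fun i => t ^ (2 * n) / (2 * n).factorial * 𝔼 γ ∈ s i, X i γ ^ (2 * n)) l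
      (𝓝 ((t ^ 2 / 2) ^ n / n.factorial)) := by
    convert (h (2 * n)).const_mul _ using 2
    have h1 : ((2 * n).factorial : ℝ) ≠ 0 := mod_cast (2 * n).factorial_ne_zero
    rw [stdGaussianMoment_two_mul, div_pow, pow_mul]
    field_simp
  have hlim := (hM.add (tendsto_iff_dist_tendsto_zero.1 hP)).add_const
    (dist (Q n) (Complex.exp (-(t : ℂ) ^ 2 / 2)))
  rw [add_zero] at hlim
  filter_upwards [hlim.eventually_lt_const hn] with i hi
  refine lt_of_le_of_lt ((dist_triangle4 _ (P i) (Q n) _).trans ?_) hi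
  gcongr
  rw [dist_eq_norm]
  exact norm_expect_cexp_sub_sum_range_le _ _ _ _

/-- A version of Slutsky's theorem for characteristic functions. -/
lemma tendsto_expect_cexp_sub_expect_cexp (hs : ∀ i, (s i).Nonempty) {M : ℝ}
    (hX : Tendsto (fun i => 𝔼 γ ∈ s i, X i γ ^ 2) l (𝓝 M))
    (hXY : ∀ ε > 0, Tendsto
      (fun i => (#{γ ∈ s i | ε * |X i γ| < |Y i γ - X i γ|} : ℝ) / #(s i)) l (𝓝 0)) (t : ℝ) :
    Tendsto (fun i => (𝔼 γ ∈ s i, Complex.exp (t * Y i γ * Complex.I)) -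
      𝔼 γ ∈ s i, Complex.exp (t * X i γ * Complex.I)) l (𝓝 0) := by
  have key (ε : ℝ) (hε : 0 < ε) (i : ι) :
      ‖(𝔼 γ ∈ s i, Complex.exp (t * Y i γ * Complex.I)) -
        𝔼 γ ∈ s i, Complex.exp (t * X i γ * Complex.I)‖ ≤
      2 * ((#{γ ∈ s i | ε * |X i γ| < |Y i γ - X i γ|} : ℝ) / #(s i)) +
        |t| * ε * ((𝔼 γ ∈ s i, X i γ ^ 2) + 1) := by
    have h1 : (#{γ ∈ s i | ε * |X i γ| < |Y i γ - X i γ|} : ℝ) / #(s i) =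
        𝔼 γ ∈ s i, if ε * |X i γ| < |Y i γ - X i γ| then (1 : ℝ) else 0 := by
      rw [expect_eq_sum_div_card]; simp
    have h2 : (𝔼 γ ∈ s i, X i γ ^ 2) + 1 = 𝔼 γ ∈ s i, (X i γ ^ 2 + 1) := by
      rw [expect_add_distrib, expect_const (hs i)]
    rw [h1, h2, mul_expect, mul_expect, ← expect_add_distrib, ← expect_sub_distrib]
    refine (RCLike.norm_expect_le (K := ℂ)).trans (expect_le_expect fun γ _ => ?_)
    split_ifs with hγ
    · have : 0 ≤ |t| * ε * (X i γ ^ 2 + 1) := by positivity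
      refine (norm_sub_le _ _).trans ?_
      rw [← Complex.ofReal_mul, ← Complex.ofReal_mul, Complex.norm_exp_ofReal_mul_I,
        Complex.norm_exp_ofReal_mul_I]
      linarith
    · have h3 : Complex.exp (t * Y i γ * Complex.I) - Complex.exp (t * X i γ * Complex.I) =
          Complex.exp ((t * X i γ : ℝ) * Complex.I) *
            (Complex.exp (Complex.I * (t * (Y i γ - X i γ) : ℝ)) - 1) := by
        rw [mul_sub, mul_one, ← Complex.exp_add]
        push_cast
        ring_nf
      rw [h3, norm_mul, Complex.norm_exp_ofReal_mul_I, one_mul, mul_zero, zero_add]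
      refine Real.norm_exp_I_mul_ofReal_sub_one_le.trans ?_
      rw [Real.norm_eq_abs, abs_mul, mul_assoc]
      gcongr
      refine (not_lt.1 hγ).trans ?_
      gcongr
      nlinarith [sq_nonneg (|X i γ| - 1), sq_abs (X i γ)]
  rw [tendsto_zero_iff_norm_tendsto_zero, Metric.tendsto_nhds]
  intro δ hδ
  have hc : Tendsto (fun ε : ℝ => |t| * ε * (M + 1)) (𝓝[>] 0) (𝓝 0) := by
    have : Continuous fun ε : ℝ => |t| * ε * (M + 1) := by fun_prop
    simpa using (this.tendsto 0).mono_left nhdsWithin_le_nhds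
  obtain ⟨ε, hεδ, hε⟩ := ((hc.eventually_lt_const hδ).and self_mem_nhdsWithin).exists
  have hlim := ((hXY ε hε).const_mul 2).add ((hX.add_const 1).const_mul (|t| * ε))
  rw [mul_zero, zero_add] at hlim
  filter_upwards [hlim.eventually_lt_const hεδ] with i hi
  simpa using (key ε hε i).trans_lt hi

/-- The empirical distribution of `f` over the finite set `s`. -/
noncomputable def empiricalMeasure (s : Finset Γ) (f : Γ → ℝ) : Measure ℝ :=
  (#s : ℝ≥0∞)⁻¹ • ∑ γ ∈ s, Measure.dirac (f γ)

lemma isProbabilityMeasure_empiricalMeasure {s : Finset Γ} (hs : s.Nonempty) (f : Γ → ℝ) :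
    IsProbabilityMeasure (empiricalMeasure s f) where
  measure_univ := by
    simp [empiricalMeasure, ENNReal.inv_mul_cancel, hs.ne_empty]

lemma charFun_empiricalMeasure (s : Finset Γ) (f : Γ → ℝ) (t : ℝ) :
    charFun (empiricalMeasure s f) t = 𝔼 γ ∈ s, Complex.exp (t * f γ * Complex.I) := by
  rw [charFun_apply_real, empiricalMeasure, integral_smul_measure,
    integral_finsetSum_measure fun γ _ => integrable_dirac (by simp), expect_eq_sum_div_card]
  simp [div_eq_inv_mul]

lemma empiricalMeasure_apply (s : Finset Γ) (f : Γ → ℝ) {E : Set ℝ} [DecidablePred (· ∈ E)]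
    (hE : MeasurableSet E) :
    (empiricalMeasure s f E).toReal = (#{γ ∈ s | f γ ∈ E} : ℝ) / #s := by
  simp [empiricalMeasure, hE, Set.indicator_apply, div_eq_inv_mul]

lemma gaussianReal_Icc_toReal {A B : ℝ} (hAB : A ≤ B) :
    (gaussianReal 0 1 (Set.Icc A B)).toReal =
      (1 / √(2 * π)) * ∫ t in A..B, Real.exp (-t ^ 2 / 2) := by
  rw [gaussianReal_apply_eq_integral _ one_ne_zero, ENNReal.toReal_ofReal
    (integral_nonneg fun x => gaussianPDFReal_nonneg _ _ _), integral_Icc_eq_integral_Ioc,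
    ← intervalIntegral.integral_of_le hAB, ← intervalIntegral.integral_const_mul]
  simp [gaussianPDFReal]

/-- Lévy's continuity theorem for empirical distributions with standard Gaussian limit. -/
lemma tendsto_card_filter_Icc_div_card [l.IsCountablyGenerated] (hs : ∀ i, (s i).Nonempty)
    (h : ∀ t : ℝ, Tendsto (fun i => 𝔼 γ ∈ s i, Complex.exp (t * Y i γ * Complex.I)) l
      (𝓝 (Complex.exp (-(t : ℂ) ^ 2 / 2)))) {A B : ℝ} (hAB : A ≤ B) :
    Tendsto (fun i => (#{γ ∈ s i | Y i γ ∈ Set.Icc A B} : ℝ) / #(s i)) l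
      (𝓝 ((1 / √(2 * π)) * ∫ t in A..B, Real.exp (-t ^ 2 / 2))) := by
  let μ (i : ι) : ProbabilityMeasure ℝ :=
    ⟨empiricalMeasure (s i) (Y i), isProbabilityMeasure_empiricalMeasure (hs i) _⟩
  let μ₀ : ProbabilityMeasure ℝ := ⟨gaussianReal 0 1, inferInstance⟩
  have hμ : Tendsto μ l (𝓝 μ₀) := by
    refine tendsto_of_seq_tendsto fun u hu => ProbabilityMeasure.tendsto_of_tendsto_charFun
      fun t => ?_
    have h₀ : charFun (μ₀ : Measure ℝ) t = Complex.exp (-(t : ℂ) ^ 2 / 2) := by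
      change charFun (gaussianReal 0 1) t = _
      rw [charFun_gaussianReal]
      congr 1
      push_cast
      ring
    rw [h₀]
    exact ((h t).comp hu).congr fun n => (charFun_empiricalMeasure _ _ _).symm
  have hnull : (μ₀ : Measure ℝ) (frontier (Set.Icc A B)) = 0 := by
    refine gaussianReal_absolutelyContinuous 0 one_ne_zero ?_
    rw [frontier_Icc hAB]
    exact (Set.toFinite _).measure_zero _
  have key : Tendsto (fun i => (empiricalMeasure (s i) (Y i) (Set.Icc A B)).toReal) l
      (𝓝 (gaussianReal 0 1 (Set.Icc A B)).toReal) :=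
    (ENNReal.tendsto_toReal (measure_ne_top _ _)).comp
      (ProbabilityMeasure.tendsto_measure_of_null_frontier_of_tendsto' hμ hnull)
  simpa only [empiricalMeasure_apply _ _ measurableSet_Icc, gaussianReal_Icc_toReal hAB] using key

lemma expect_div_pow (s : Finset Γ) (a : Γ → ℝ) (q : ℝ) (k : ℕ) :
    𝔼 γ ∈ s, (a γ / q) ^ k = (∑ γ ∈ s, a γ ^ k) / (#s * q ^ k) := by
  simp_rw [div_pow, expect_eq_sum_div_card, ← sum_div, div_div]
  rw [mul_comm]

end Expectation

section PowerSums

variable {Γ : Type*} {s : ℝ → Finset Γ} {a r : Γ → ℝ} {C c : ℝ}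

lemma tendsto_expect_div_sqrt_pow_stdGaussianMoment (hC : 0 < C) (hc : 0 < c)
    (hN : (fun x : ℝ => (#(s x) : ℝ)) ~[atTop] fun x => C * Real.exp x)
    (heven : ∀ m : ℕ, (fun x : ℝ => ∑ γ ∈ s x, a γ ^ (2 * m)) ~[atTop]
      fun x => C * c ^ m * ((2 * m).factorial / m.factorial : ℝ) * Real.exp x * x ^ m)
    (hodd : ∀ m : ℕ, (fun x : ℝ => ∑ γ ∈ s x, a γ ^ (2 * m + 1)) =O[atTop]
      fun x => Real.exp x * x ^ m) (k : ℕ) :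
    Tendsto (fun x => 𝔼 γ ∈ s x, (a γ / √(2 * c * x)) ^ k) atTop (𝓝 (stdGaussianMoment k)) := by
  simp_rw [expect_div_pow]
  obtain ⟨m, rfl | rfl⟩ := k.even_or_odd'
  · refine ((heven m).div (hN.mul (IsEquivalent.refl
      (u := fun x => √(2 * c * x) ^ (2 * m))))).symm.tendsto_nhds ?_
    refine tendsto_const_nhds.congr' ?_
    filter_upwards [eventually_gt_atTop 0] with x hx
    have h1 : (m.factorial : ℝ) ≠ 0 := mod_cast m.factorial_ne_zero
    have h2 := Real.exp_pos x
    simp only [Pi.div_apply, Pi.mul_apply]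
    rw [stdGaussianMoment_two_mul, pow_mul √_, Real.sq_sqrt (by positivity), mul_pow, mul_pow]
    field_simp
  · rw [stdGaussianMoment_two_mul_add_one]
    have hsqrt : Tendsto (fun x => √(2 * c * x)) atTop atTop :=
      Real.tendsto_sqrt_atTop.comp (tendsto_id.const_mul_atTop (by positivity))
    have hone : (fun _ : ℝ => (1 : ℝ)) =o[atTop] fun x => √(2 * c * x) :=
      (isLittleO_const_left.2 (Or.inr (tendsto_norm_atTop_atTop.comp hsqrt)))
    have hlo := ((isBigO_refl (fun x : ℝ => Real.exp x * x ^ m) atTop).mul_isLittleO hone)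
    have hlo' : (fun x : ℝ => Real.exp x * x ^ m) =o[atTop]
        fun x => C * Real.exp x * √(2 * c * x) ^ (2 * m + 1) := by
      refine (hlo.const_mul_right (c := C * (2 * c) ^ m) (by positivity)).congr'
        (Eventually.of_forall fun x => by simp) ?_
      filter_upwards [eventually_ge_atTop 0] with x hx
      rw [pow_succ, pow_mul √_, Real.sq_sqrt (by positivity), mul_pow]
      ring
    exact ((hodd m).trans_isLittleO (hlo'.trans_isBigO
      (hN.mul (IsEquivalent.refl (u := fun x => √(2 * c * x) ^ (2 * m + 1)))).isBigO_symm)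
      ).tendsto_div_nhds_zero

lemma abs_div_sqrt_sub_div_sqrt_le {r x ε : ℝ} (hc : 0 < c) (hr : 0 < r) (hrx : r ≤ x)
    (hε : 0 ≤ ε) (hxr : x ≤ (1 + ε) ^ 2 * r) (y : ℝ) :
    |y / √(2 * c * r) - y / √(2 * c * x)| ≤ ε * |y / √(2 * c * x)| := by
  have hu : 0 < √(2 * c * r) := by positivity
  have huv : √(2 * c * r) ≤ √(2 * c * x) := by gcongr
  have hv : 0 < √(2 * c * x) := hu.trans_le huv
  have hvu : √(2 * c * x) ≤ (1 + ε) * √(2 * c * r) := by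
    rw [← Real.sqrt_sq (by positivity : (0 : ℝ) ≤ 1 + ε), ← Real.sqrt_mul (by positivity)]
    refine Real.sqrt_le_sqrt ?_
    nlinarith
  have h : y / √(2 * c * r) - y / √(2 * c * x) =
      (√(2 * c * x) / √(2 * c * r) - 1) * (y / √(2 * c * x)) := by
    field_simp
  rw [h, abs_mul, abs_of_nonneg (sub_nonneg.2 ((one_le_div hu).2 huv))]
  gcongr
  rw [sub_le_iff_le_add', div_le_iff₀ hu]
  exact hvu

lemma tendsto_card_filter_lt_abs_sub_div_card (hC : 0 < C) (hc : 0 < c) (hr : ∀ γ, 0 < r γ)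
    (hs : ∀ x γ, γ ∈ s x ↔ r γ ≤ x)
    (hN : (fun x : ℝ => (#(s x) : ℝ)) ~[atTop] fun x => C * Real.exp x) {ε : ℝ} (hε : 0 < ε) :
    Tendsto (fun x => (#{γ ∈ s x | ε * |a γ / √(2 * c * x)| <
      |a γ / √(2 * c * r γ) - a γ / √(2 * c * x)|} : ℝ) / #(s x)) atTop (𝓝 0) := by
  set κ : ℝ := ((1 + ε) ^ 2)⁻¹
  have hκ₀ : 0 < κ := by positivity
  have hκ : κ < 1 := inv_lt_one_of_one_lt₀ (by nlinarith)
  have hκN : Tendsto (fun x => (#(s (κ * x)) : ℝ) / #(s x)) atTop (𝓝 0) := by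
    refine ((hN.comp_tendsto (tendsto_id.const_mul_atTop hκ₀)).div hN).symm.tendsto_nhds ?_
    have : Tendsto (fun x : ℝ => Real.exp ((κ - 1) * x)) atTop (𝓝 0) :=
      Real.tendsto_exp_atBot.comp (tendsto_id.const_mul_atTop_of_neg (by linarith))
    refine this.congr fun x => ?_
    simp only [Pi.div_apply, Function.comp_apply, id]
    rw [mul_div_mul_left _ _ hC.ne', ← Real.exp_sub]
    ring_nf
  refine squeeze_zero (fun x => by positivity) (fun x => ?_) hκN
  gcongr
  intro γ hγ
  rw [mem_filter, hs] at hγ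
  rw [hs]
  by_contra! h
  refine hγ.2.not_ge (abs_div_sqrt_sub_div_sqrt_le hc (hr γ) hγ.1 hε.le ?_ _)
  exact ((inv_mul_lt_iff₀ (by positivity)).1 h).le

end PowerSums

/-- method of moments for modular-symbol type data. `a γ` plays the role of
`⟨γ⟩`, `r γ` of `r(γz,w)`. If `N(x) = #{γ : r γ ≤ x} ~ C eˣ`, the even power sums satisfy
`Σ_{r γ ≤ x} a γ^{2m} ~ C·cᵐ·(2m)!/m!·eˣ xᵐ` and the odd power sums are `O(eˣ xᵐ)`, then the
normalized values `a γ / √(2c·r γ)` are asymptotically Gaussian distributed. -/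
theorem stmt_9 {Γ : Type*} (r : Γ → ℝ) (a : Γ → ℝ) (C c : ℝ) (hC : 0 < C) (hc : 0 < c)
    (hrpos : ∀ γ, 0 < r γ)
    (hfin : ∀ x : ℝ, {γ : Γ | r γ ≤ x}.Finite)
    (hN : (fun x : ℝ => (Nat.card {γ : Γ | r γ ≤ x} : ℝ)) ~[atTop]
      fun x => C * Real.exp x)
    (heven : ∀ m : ℕ,
      (fun x : ℝ => ∑ γ ∈ (hfin x).toFinset, a γ ^ (2 * m)) ~[atTop]
        fun x => C * c ^ m * ((2 * m).factorial / m.factorial : ℝ) * Real.exp x * x ^ m)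
    (hodd : ∀ m : ℕ,
      (fun x : ℝ => ∑ γ ∈ (hfin x).toFinset, a γ ^ (2 * m + 1)) =O[atTop]
        fun x => Real.exp x * x ^ m) :
    ∀ A B : ℝ, A < B →
      Tendsto
        (fun x : ℝ =>
          (Nat.card {γ : Γ | r γ ≤ x ∧ a γ / Real.sqrt (2 * c * r γ) ∈ Set.Icc A B} : ℝ) /
            (Nat.card {γ : Γ | r γ ≤ x} : ℝ))
        atTop
        (nhds ((1 / Real.sqrt (2 * π)) * ∫ t in A..B, Real.exp (-t ^ 2 / 2))) := by
  intro A B hAB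
  set s : ℝ → Finset Γ := fun x => (hfin x).toFinset
  have hs (x : ℝ) (γ : Γ) : γ ∈ s x ↔ r γ ≤ x := by simp [s]
  have hcard (x : ℝ) : Nat.card {γ : Γ | r γ ≤ x} = #(s x) :=
    Nat.card_eq_card_finite_toFinset (hfin x)
  have hcardIcc (x : ℝ) :
      Nat.card {γ : Γ | r γ ≤ x ∧ a γ / √(2 * c * r γ) ∈ Set.Icc A B} =
        #{γ ∈ s x | a γ / √(2 * c * r γ) ∈ Set.Icc A B} := by
    rw [Nat.card_coe_set_eq, ← Set.ncard_coe_finset]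
    congr 1
    ext γ
    simp [hs]
  simp_rw [hcard] at hN
  simp_rw [hcard, hcardIcc]
  have hpos : ∀ᶠ x in atTop, (s x).Nonempty := by
    have hlim : Tendsto (fun x => (#(s x) : ℝ)) atTop atTop :=
      hN.symm.tendsto_atTop (Real.tendsto_exp_atTop.const_mul_atTop hC)
    filter_upwards [hlim.eventually_gt_atTop 0] with x hx
    exact card_pos.1 (mod_cast hx)
  obtain ⟨x₀, hx₀⟩ := eventually_atTop.1 hpos
  have hmom := tendsto_expect_div_sqrt_pow_stdGaussianMoment hC hc hN heven hodd
  rw [← tendsto_comp_val_Ici_atTop (a := x₀)]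
  refine tendsto_card_filter_Icc_div_card (s := fun x : Set.Ici x₀ => s x)
    (Y := fun _ γ => a γ / √(2 * c * r γ)) (fun x => hx₀ x x.2) (fun t => ?_) hAB.le
  have hmom' (k : ℕ) := tendsto_comp_val_Ici_atTop (a := x₀) |>.2 (hmom k)
  simpa using (tendsto_expect_cexp_sub_expect_cexp (fun x : Set.Ici x₀ => hx₀ x x.2) (hmom' 2)
    (fun ε hε => tendsto_comp_val_Ici_atTop.2
      (tendsto_card_filter_lt_abs_sub_div_card hC hc hrpos hs hN hε)) t).add
    (tendsto_expect_cexp_of_tendsto_expect_pow hmom' t)
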